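/- Every finite group of order 210 has at least 17 conjugacy classes, and there exists a group of order 210 with exactly 17 conjugacy classes. -/

import Mathlib

open Subgroup in
/-- The class size bound: the class of `g` has exactly `index (centralizer g)` elements. -/
lemma ccl_card {G : Type} [Group G] [Fintype G] [DecidableEq (ConjClasses G)] (g : G) :
    (Finset.univ.filter (fun x : G => ConjClasses.mk x = ConjClasses.mk g)).card
      = (centralizer {g}).index := by
  classical
  have h1 := ConjClasses.card_carrier g
  have h2 : Fintype.card (ConjClasses.mk g).carrier =
      (Finset.univ.filter (fun x : G => ConjClasses.mk x = ConjClasses.mk g)).card := by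
    rw [Fintype.card_subtype]
    congr 1
    ext x
    simp [ConjClasses.mem_carrier_iff_mk_eq]
  rw [← h2, h1, ← Nat.card_eq_fintype_card, ← Nat.card_eq_fintype_card (α := MulAction.stabilizer _ _),
    ← nat_card_centralizer_nat_card_stabilizer, ← (centralizer {g}).card_mul_index,
    Nat.mul_div_cancel_left _ Nat.card_pos]

/-- Counting classes with given label, from a set of elements with small classes. -/
lemma count_classes {G : Type} [Group G] [Fintype G] [Fintype (ConjClasses G)]
    (P : ConjClasses G → Prop) [DecidablePred P] (S : Finset G) (d : ℕ)
    (hS : ∀ g ∈ S, P (ConjClasses.mk g)) (hd : ∀ g ∈ S, (Subgroup.centralizer {g}).index ≤ d) :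
    S.card ≤ d * (Finset.univ.filter P).card := by
  classical
  refine (Finset.card_le_mul_card_image (f := ConjClasses.mk) S d ?_).trans ?_
  · intro b hb
    obtain ⟨g, hg, rfl⟩ := Finset.mem_image.1 hb
    refine le_trans ?_ (hd g hg)
    rw [← ccl_card]
    exact Finset.card_le_card (Finset.filter_subset_filter _ (Finset.subset_univ _))
  · refine Nat.mul_le_mul_left _ (Finset.card_le_card ?_)
    intro b hb
    obtain ⟨g, hg, rfl⟩ := Finset.mem_image.1 hb
    simpa using hS g hg

lemma zpowers_normal {G : Type} [Group G] (N : Subgroup G) [N.Normal] [IsCyclic N] (g : G)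
    (hg : g ∈ N) : (Subgroup.zpowers g).Normal := by
  refine ⟨fun x hx h => ?_⟩
  obtain ⟨m, hm⟩ := MonoidHom.map_cyclic ((MulAut.conjNormal h : MulAut N).toMonoidHom)
  have hxN : x ∈ N := (Subgroup.zpowers_le.2 hg) hx
  have := congrArg Subtype.val (hm ⟨x, hxN⟩)
  simp at this
  rw [this]
  exact Subgroup.zpow_mem _ hx m

/-- class sizes in a cyclic normal subgroup -/
lemma index_dvd {G : Type} [Group G] [Finite G] (N : Subgroup G) [N.Normal] [IsCyclic N] (g : G)
    (hg : g ∈ N) : (Subgroup.centralizer {g}).index ∣ Nat.gcd N.index (Nat.totient (orderOf g)) := by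
  refine Nat.dvd_gcd ?_ ?_
  · apply Subgroup.index_dvd_of_le
    intro x hx
    rw [Subgroup.mem_centralizer_singleton_iff]
    have := (IsCyclic.isMulCommutative (α := N)).is_comm.comm ⟨x, hx⟩ ⟨g, hg⟩
    simpa using congrArg Subtype.val this
  · have := zpowers_normal N g hg
    let f : G →* MulAut (Subgroup.zpowers g) := MulAut.conjNormal
    have hk : f.ker ≤ Subgroup.centralizer {g} := by
      intro x hx
      rw [Subgroup.mem_centralizer_singleton_iff]
      have h1 := congrArg Subtype.val (DFunLike.congr_fun (MonoidHom.mem_ker.1 hx) ⟨g, Subgroup.mem_zpowers g⟩)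
      simp only [f, MulAut.conjNormal_apply, MulAut.one_apply] at h1
      exact mul_inv_eq_iff_eq_mul.1 h1
    refine (Subgroup.index_dvd_of_le hk).trans ?_
    rw [Subgroup.index_ker]
    refine (Subgroup.card_subgroup_dvd_card _).trans ?_
    rw [IsCyclic.card_mulAut, Nat.card_zpowers]

/-- label of a class in the abelianization -/
def lab {G : Type} [Group G] : ConjClasses G → Abelianization G :=
  Quotient.lift (fun g => Abelianization.of g)
    (fun a b h => by
      have : IsConj a b := h
      exact isConj_iff_eq.1 (Abelianization.of.map_isConj this))

@[simp] lemma lab_mk {G : Type} [Group G] (g : G) : lab (ConjClasses.mk g) = Abelianization.of g := rfl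

/-- order of a class -/
noncomputable def ord {G : Type} [Group G] : ConjClasses G → ℕ :=
  Quotient.lift (fun g => orderOf g)
    (fun a b h => by
      have : IsConj a b := h
      obtain ⟨c, rfl⟩ := isConj_iff.1 this
      exact (MulEquiv.orderOf_eq (MulAut.conj c) a).symm)

@[simp] lemma ord_mk {G : Type} [Group G] (g : G) : ord (ConjClasses.mk g) = orderOf g := rfl

lemma of_eq_one_iff {G : Type} [Group G] (g : G) : Abelianization.of g = 1 ↔ g ∈ commutator G := by
  rw [← Abelianization.ker_of, MonoidHom.mem_ker]

lemma fiber_one {G : Type} [Group G] [Fintype G] [Fintype (ConjClasses G)]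
    [DecidableEq (Abelianization G)] [IsCyclic (commutator G)] :
    ∑ d ∈ (Nat.card (commutator G)).divisors,
      Nat.totient d / Nat.gcd (commutator G).index (Nat.totient d)
    ≤ (Finset.univ.filter (fun c : ConjClasses G => lab c = 1)).card := by
  classical
  calc _ ≤ ∑ d ∈ (Nat.card (commutator G)).divisors,
        ((Finset.univ.filter (fun c : ConjClasses G => lab c = 1)).filter (fun c => ord c = d)).card := by
        refine Finset.sum_le_sum fun d hd => ?_
        refine Nat.div_le_of_le_mul ?_
        rw [Finset.filter_filter]
        have h := count_classes (fun c : ConjClasses G => lab c = 1 ∧ ord c = d)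
          ((Finset.univ.filter (fun x : commutator G => orderOf x = d)).map
            (Function.Embedding.subtype _))
          (Nat.gcd (commutator G).index (Nat.totient d)) ?_ ?_
        · rwa [Finset.card_map, IsCyclic.card_orderOf_eq_totient] at h
          rw [← Nat.card_eq_fintype_card]
          exact Nat.dvd_of_mem_divisors hd
        · intro g hg
          simp only [Finset.mem_map, Finset.mem_filter, Finset.mem_univ, true_and] at hg
          obtain ⟨x, hx, rfl⟩ := hg
          refine ⟨(of_eq_one_iff _).2 x.2, ?_⟩
          simpa using hx
        · intro g hg
          simp only [Finset.mem_map, Finset.mem_filter, Finset.mem_univ, true_and] at hg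
          obtain ⟨x, hx, rfl⟩ := hg
          have h1 := index_dvd (commutator G) (x : G) x.2
          rw [Subgroup.orderOf_coe, hx] at h1
          refine Nat.le_of_dvd (Nat.gcd_pos_of_pos_left _ ?_) h1
          exact Nat.pos_of_ne_zero Subgroup.index_ne_zero_of_finite
    _ ≤ _ := by
        rw [← Finset.card_biUnion]
        · refine Finset.card_le_card ?_
          intro c hc
          simp at hc ⊢
          exact hc.2
        · intro a _ b _ hab
          rw [Function.onFun, Finset.disjoint_left]
          intro c hc hc'
          simp at hc hc'
          exact hab (hc.2.symm.trans hc'.2)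

lemma total {G : Type} [Group G] [Fintype G] [Fintype (ConjClasses G)]
    [Fintype (Abelianization G)] [DecidableEq (Abelianization G)] :
    Nat.card (ConjClasses G) =
     ∑ a : Abelianization G, (Finset.univ.filter (fun c : ConjClasses G => lab c = a)).card := by
  rw [Nat.card_eq_fintype_card, ← Finset.card_univ]
  exact Finset.card_eq_sum_card_fiberwise (fun _ _ => Finset.mem_univ _)

lemma fiber_pos {G : Type} [Group G] [Fintype G] [Fintype (ConjClasses G)]
    [DecidableEq (Abelianization G)] (a : Abelianization G) :
    1 ≤ (Finset.univ.filter (fun c : ConjClasses G => lab c = a)).card := by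
  obtain ⟨g, rfl⟩ := QuotientGroup.mk_surjective a
  exact Finset.card_pos.2 ⟨ConjClasses.mk g, by simp; rfl⟩

lemma fiber_three {G : Type} [Group G] [Fintype G] [Fintype (ConjClasses G)]
    [DecidableEq (Abelianization G)] [IsCyclic (commutator G)] (hG : Nat.card G = 210)
    (hN : Nat.card (commutator G) = 35) (a : Abelianization G) (ha : a ≠ 1) (ha3 : a ^ 3 = 1) :
    3 ≤ (Finset.univ.filter (fun c : ConjClasses G => lab c = a)).card := by
  classical
  have hidx : (commutator G).index = 6 := by
    have := (commutator G).card_mul_index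
    rw [hG, hN] at this
    omega
  have h := count_classes (fun c : ConjClasses G => lab c = a)
    (Finset.univ.filter (fun g : G => Abelianization.of g = a)) 14 ?_ ?_
  · have h35 : (Finset.univ.filter (fun g : G => Abelianization.of g = a)).card = 35 := by
      have hh := MonoidHom.card_fiber_eq_of_mem_range (Abelianization.of (G := G)) (x := a) (y := 1)
        (QuotientGroup.mk_surjective a) ⟨1, map_one _⟩
      refine Eq.trans (by convert hh) (Eq.trans ?_ hN)
      rw [Nat.card_eq_fintype_card,
        Fintype.card_subtype]
      congr 1
      ext g
      simp [of_eq_one_iff]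
    omega
  · intro g hg
    simpa using hg
  · intro g hg
    have hg : Abelianization.of g = a := by simpa using hg
    obtain ⟨x, hx⟩ := exists_prime_orderOf_dvd_card' (G := commutator G) (hp := ⟨by norm_num⟩) 5
      (by rw [hN]; norm_num)
    have hi := index_dvd (commutator G) (x : G) x.2
    rw [Subgroup.orderOf_coe, hx, hidx, show Nat.totient 5 = 4 by decide,
      show Nat.gcd 6 4 = 2 by norm_num] at hi
    have hsq : g ^ 2 ∈ Subgroup.centralizer {(x : G)} := by
      rcases (Nat.dvd_prime Nat.prime_two).1 hi with h1 | h1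
      · rw [Subgroup.index_eq_one.1 h1]; trivial
      · exact Subgroup.sq_mem_of_index_two h1 g
    have hcu : g ^ 3 ∈ Subgroup.centralizer {(x : G)} := by
      rw [Subgroup.mem_centralizer_singleton_iff]
      have h3 : g ^ 3 ∈ commutator G := by
        rw [← of_eq_one_iff, map_pow, hg, ha3]
      have := (IsCyclic.isMulCommutative (α := commutator G)).is_comm.comm ⟨g ^ 3, h3⟩ x
      simpa using congrArg Subtype.val this
    have hgx : g ∈ Subgroup.centralizer {(x : G)} := by
      have : g = g ^ 3 * (g ^ 2)⁻¹ := by group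
      rw [this]
      exact Subgroup.mul_mem _ hcu (Subgroup.inv_mem _ hsq)
    have hxg : (x : G) ∈ Subgroup.centralizer {g} := by
      rw [Subgroup.mem_centralizer_singleton_iff] at hgx ⊢
      exact hgx.symm
    have d5 : 5 ∣ Nat.card (Subgroup.centralizer {g}) := by
      have := Subgroup.orderOf_dvd_natCard _ hxg
      rwa [Subgroup.orderOf_coe, hx] at this
    have d3 : 3 ∣ Nat.card (Subgroup.centralizer {g}) := by
      have h1 : g ∈ Subgroup.centralizer {g} := by
        rw [Subgroup.mem_centralizer_singleton_iff]
      refine Dvd.dvd.trans ?_ (Subgroup.orderOf_dvd_natCard _ h1)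
      have h2 : orderOf a = 3 := orderOf_eq_prime (hp := ⟨by norm_num⟩) ha3 ha
      rw [← h2, ← hg]
      exact orderOf_map_dvd _ g
    have d15 : 15 ∣ Nat.card (Subgroup.centralizer {g}) :=
      Nat.Coprime.mul_dvd_of_dvd_of_dvd (by norm_num : Nat.Coprime 3 5) d3 d5
    have hm := (Subgroup.centralizer {g}).card_mul_index
    rw [hG] at hm
    have : 15 ≤ Nat.card (Subgroup.centralizer {g}) := Nat.le_of_dvd Nat.card_pos d15
    nlinarith

lemma arith : ∀ n ∈ Nat.divisors 210, n ≠ 35 →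
    17 ≤ (∑ d ∈ n.divisors, Nat.totient d / Nat.gcd (210 / n) (Nat.totient d)) + (210 / n - 1) := by
  decide +kernel

theorem lower (G : Type) [Group G] [Finite G] (hG : Nat.card G = 210) :
    17 ≤ Nat.card (ConjClasses G) := by
  classical
  have := Fintype.ofFinite G
  have : Fintype (ConjClasses G) := Fintype.ofFinite _
  have : Finite (Abelianization G) := inferInstanceAs (Finite (G ⧸ commutator G))
  have : Fintype (Abelianization G) := Fintype.ofFinite _
  have : IsZGroup G := IsZGroup.of_squarefree (by
    rw [hG]
    decide +kernel)
  have hcyc : IsCyclic (commutator G) := IsZGroup.isCyclic_commutator G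
  have hmul := (commutator G).card_mul_index
  rw [hG] at hmul
  have hq : Fintype.card (Abelianization G) = (commutator G).index := by
    rw [← Nat.card_eq_fintype_card]; rfl
  have h1 := fiber_one (G := G)
  rw [total]
  generalize hn : Nat.card (commutator G) = n at *
  have hpos : 0 < n := by
    rcases Nat.eq_zero_or_pos n with h | h
    · simp [h] at hmul
    · exact h
  have hidx : (commutator G).index = 210 / n := by
    rw [← hmul, Nat.mul_div_cancel_left _ hpos]
  rw [hidx] at h1 hq
  by_cases h35 : n = 35
  · subst h35
    let w : Abelianization G → ℕ := fun a => if a = 1 then 8 else if a ^ 3 = 1 then 3 else 1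
    have hw : ∑ a, w a = 17 := by
      have e : Abelianization G ≃* Multiplicative (ZMod 6) := mulEquivOfCyclicCardEq (by
        rw [Nat.card_eq_fintype_card, hq]; simp)
      have h2 : ∑ b : Multiplicative (ZMod 6), (if b = 1 then 8 else if b ^ 3 = 1 then 3 else 1) = 17 := by
        decide +kernel
      rw [← h2]
      refine Fintype.sum_equiv e.toEquiv _ _ fun a => ?_
      simp [w, ← map_pow]
    rw [← hw]
    refine Finset.sum_le_sum fun a _ => ?_
    by_cases ha : a = 1
    · subst ha
      simp only [w, if_true]
      refine le_trans ?_ h1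
      decide +kernel
    · by_cases ha3 : a ^ 3 = 1
      · simp only [w, if_neg ha, if_pos ha3]
        exact fiber_three hG hn a ha ha3
      · simp only [w, if_neg ha, if_neg ha3]
        exact fiber_pos a
  · have h2 := arith n (Nat.mem_divisors.2 ⟨⟨_, hmul.symm⟩, by norm_num⟩) h35
    rw [← Finset.add_sum_erase _ _ (Finset.mem_univ (1 : Abelianization G))]
    refine h2.trans (Nat.add_le_add h1 ?_)
    calc 210 / n - 1 = (Finset.univ.erase (1 : Abelianization G)).card • 1 := by
          rw [Finset.card_erase_of_mem (Finset.mem_univ _), Finset.card_univ, hq]; simp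
      _ ≤ _ := Finset.card_nsmul_le_sum _ _ _ fun a _ => fiber_pos a

/-- The extremal group: affine maps `x ↦ 24 ^ k * x + b` of `ZMod 35`. -/
@[ext] structure Aff where
  b : ZMod 35
  k : ZMod 6

namespace Aff

/-- The multiplier `24 ^ k`. -/
def u (k : ZMod 6) : ZMod 35 := 24 ^ k.val

lemma u_add : ∀ i j : ZMod 6, u (i + j) = u i * u j := by decide +kernel

instance : Mul Aff := ⟨fun x y => ⟨x.b + u x.k * y.b, x.k + y.k⟩⟩
instance : One Aff := ⟨⟨0, 0⟩⟩
instance : Inv Aff := ⟨fun x => ⟨-(u (-x.k) * x.b), -x.k⟩⟩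

lemma mul_def (x y : Aff) : x * y = ⟨x.b + u x.k * y.b, x.k + y.k⟩ := rfl
lemma one_def : (1 : Aff) = ⟨0, 0⟩ := rfl
lemma inv_def (x : Aff) : x⁻¹ = ⟨-(u (-x.k) * x.b), -x.k⟩ := rfl

lemma u_zero : u 0 = 1 := by decide +kernel

instance : Group Aff := Group.ofLeftAxioms
  (by
    intro x y z
    simp only [mul_def, u_add]
    ext <;> simp <;> ring)
  (by
    intro x
    simp only [mul_def, one_def, u_zero]
    ext <;> simp)
  (by
    intro x
    simp only [mul_def, one_def, inv_def]
    ext <;> simp)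

/-- as a product -/
def equiv : Aff ≃ ZMod 35 × ZMod 6 where
  toFun x := (x.b, x.k)
  invFun p := ⟨p.1, p.2⟩
  left_inv _ := rfl
  right_inv _ := rfl

instance : Finite Aff := Finite.of_equiv _ equiv.symm

lemma card : Nat.card Aff = 210 := by
  rw [Nat.card_congr equiv]; simp

/-- Class representatives. -/
def reps : Fin 17 → ZMod 35 × ZMod 6 :=
  ![(0, 0), (1, 0), (2, 0), (4, 0), (5, 0), (7, 0), (8, 0), (14, 0), (0, 1), (0, 2), (1, 2),
    (2, 2), (0, 3), (0, 4), (1, 4), (2, 4), (0, 5)]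

lemma reps_spec : ∀ (k : ZMod 6) (b : ZMod 35), ∃ c : ZMod 35, ∃ i : Fin 17,
    (reps i).2 = k ∧ ∃ j : ZMod 6, c + u j * b = (reps i).1 + u k * c := by
  decide +kernel

lemma upper : Nat.card (ConjClasses Aff) ≤ 17 := by
  have := Nat.card_le_card_of_surjective
    (fun i : Fin 17 => ConjClasses.mk (⟨(reps i).1, (reps i).2⟩ : Aff)) ?_
  · simpa using this
  · intro x
    obtain ⟨⟨b, k⟩, rfl⟩ := ConjClasses.exists_rep x
    obtain ⟨c, i, hk, j, h⟩ := reps_spec k b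
    refine ⟨i, ?_⟩
    rw [ConjClasses.mk_eq_mk_iff_isConj, isConj_comm, isConj_iff]
    refine ⟨⟨c, j⟩, ?_⟩
    rw [mul_inv_eq_iff_eq_mul]
    simp only [mul_def, hk, h, add_comm]

end Aff



/-- **Groups of order 210.**
Every finite group of order `210` has at least `17` conjugacy classes, and there exists a
group of order `210` with exactly `17` conjugacy classes. -/
theorem classNumber_order_210 :
    (∀ (G : Type) [Group G] [Finite G],
        Nat.card G = 210 → 17 ≤ Nat.card (ConjClasses G)) ∧
    (∃ (G : Type) (_ : Group G) (_ : Finite G),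
        Nat.card G = 210 ∧ Nat.card (ConjClasses G) = 17) := by
  exact ⟨fun G _ _ hG => lower G hG, Aff, inferInstance, inferInstance, Aff.card,
    le_antisymm Aff.upper (lower Aff Aff.card)⟩
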